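/- For p, q ∈ P, set H₀ = log(p^{−1/2} q p^{−1/2}) ∈ S₂(H) and γ(t) = p^{1/2} · exp(t H₀) · p^{1/2}. Then γ(t) ∈ P for all t ∈ ℝ, γ(0) = p, γ(1) = q, and d(γ(s), γ(t)) = |t − s| · d(p, q) for all s, t ∈ ℝ; i.e., γ is the (unique, constant-speed) geodesic of P through p and q. -/

import Mathlib

noncomputable section

open scoped InnerProductSpace

variable {H : Type*} [NormedAddCommGroup H] [InnerProductSpace ℂ H] [CompleteSpace H]
variable {ι : Type*}

/-- `A` is a Hilbert–Schmidt operator (w.r.t. the Hilbert basis `e`). -/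
def IsHS (e : HilbertBasis ι ℂ H) (A : H →L[ℂ] H) : Prop :=
  Summable fun i => ‖A (e i)‖ ^ 2

/-- The Hilbert–Schmidt norm of `A` (w.r.t. the Hilbert basis `e`). -/
def hsNorm (e : HilbertBasis ι ℂ H) (A : H →L[ℂ] H) : ℝ :=
  Real.sqrt (∑' i, ‖A (e i)‖ ^ 2)

/-- The real Hilbert–Schmidt inner product `⟨A, B⟩₂ = ∑ ⟪A eᵢ, B eᵢ⟫`. -/
def hsInner (e : HilbertBasis ι ℂ H) (A B : H →L[ℂ] H) : ℝ :=
  (∑' i, (inner ℂ (A (e i)) (B (e i)) : ℂ)).re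

/-- The trace of an operator, `Tr T = ∑ ⟪eᵢ, T eᵢ⟫`. -/
def opTrace (e : HilbertBasis ι ℂ H) (T : H →L[ℂ] H) : ℂ :=
  ∑' i, (inner ℂ (e i) (T (e i)) : ℂ)

/-- `T` is trace class: it is the product of two Hilbert–Schmidt operators. -/
def IsTraceClass (e : HilbertBasis ι ℂ H) (T : H →L[ℂ] H) : Prop :=
  ∃ B C : H →L[ℂ] H, IsHS e B ∧ IsHS e C ∧ T = B * C

/-- `A ∈ S₂(H)`: self-adjoint and Hilbert–Schmidt. -/
def MemS2 (e : HilbertBasis ι ℂ H) (A : H →L[ℂ] H) : Prop :=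
  IsSelfAdjoint A ∧ IsHS e A

/-- `p ∈ P`: self-adjoint, positive definite (invertible and `⟪p x, x⟫ ≥ 0`),
with `p - 1` Hilbert–Schmidt. -/
def MemP (e : HilbertBasis ι ℂ H) (p : H →L[ℂ] H) : Prop :=
  IsSelfAdjoint p ∧ IsUnit p ∧ (∀ x : H, 0 ≤ (inner ℂ (p x) x : ℂ).re) ∧ IsHS e (p - 1)

/-- `x ∈ GL₂(H)`: invertible with `x - 1` Hilbert–Schmidt. -/
def MemGL2 (e : HilbertBasis ι ℂ H) (x : H →L[ℂ] H) : Prop :=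
  IsUnit x ∧ IsHS e (x - 1)

/-- `x ∈ U₂(H)`: unitary with `x - 1` Hilbert–Schmidt. -/
def MemU2 (e : HilbertBasis ι ℂ H) (x : H →L[ℂ] H) : Prop :=
  x ∈ unitary (H →L[ℂ] H) ∧ IsHS e (x - 1)

/-- `p^{1/2}`, via continuous functional calculus. -/
def psqrt (p : H →L[ℂ] H) : H →L[ℂ] H := cfc Real.sqrt p

/-- `p^{-1/2}`, via continuous functional calculus. -/
def pinvsqrt (p : H →L[ℂ] H) : H →L[ℂ] H := cfc (fun t : ℝ => (Real.sqrt t)⁻¹) p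

/-- `log p`, via continuous functional calculus. -/
def plog (p : H →L[ℂ] H) : H →L[ℂ] H := cfc Real.log p

/-- The geodesic distance `d(p, q) = ‖log (p^{-1/2} q p^{-1/2})‖₂`. -/
def gdist (e : HilbertBasis ι ℂ H) (p q : H →L[ℂ] H) : ℝ :=
  hsNorm e (plog (pinvsqrt p * q * pinvsqrt p))

/-- The commutator `[A, B] = AB - BA`. -/
def brk (A B : H →L[ℂ] H) : H →L[ℂ] H := A * B - B * A

/-- The constant-speed geodesic `t ↦ p^{1/2} exp(t K) p^{1/2}`. -/
def geoCurve (p K : H →L[ℂ] H) (t : ℝ) : H →L[ℂ] H :=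
  psqrt p * NormedSpace.exp (t • K) * psqrt p

/-- The geodesic from `p` to `q`:
`t ↦ p^{1/2} exp(t log(p^{-1/2} q p^{-1/2})) p^{1/2}`. -/
def geodesic (p q : H →L[ℂ] H) (t : ℝ) : H →L[ℂ] H :=
  geoCurve p (plog (pinvsqrt p * q * pinvsqrt p)) t

/-- The image `exp E` of a set of operators under the exponential map. -/
def expSet (E : Set (H →L[ℂ] H)) : Set (H →L[ℂ] H) := NormedSpace.exp '' E

/-- The orthogonal complement of `E` inside `S₂(H)` for the Hilbert–Schmidt
inner product. -/
def hsPerp (e : HilbertBasis ι ℂ H) (E : Set (H →L[ℂ] H)) : Set (H →L[ℂ] H) :=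
  {Y | MemS2 e Y ∧ ∀ X ∈ E, hsInner e X Y = 0}

/-- `E` is closed in `S₂(H)` with respect to the Hilbert–Schmidt norm. -/
def IsHSClosed (e : HilbertBasis ι ℂ H) (E : Set (H →L[ℂ] H)) : Prop :=
  ∀ X : H →L[ℂ] H, MemS2 e X → (∀ ε > (0:ℝ), ∃ Y ∈ E, hsNorm e (X - Y) < ε) → X ∈ E

lemma aux_parseval (e : HilbertBasis ι ℂ H) (x : H) :
    HasSum (fun i => ‖(inner ℂ (e i) x : ℂ)‖ ^ 2) (‖x‖ ^ 2) := by
  have h := e.hasSum_inner_mul_inner x x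
  have h2 := Complex.hasSum_re h
  have e1 : (inner ℂ x x : ℂ).re = ‖x‖ ^ 2 := by
    rw [inner_self_eq_norm_sq_to_K]; norm_cast
  rw [e1] at h2
  refine h2.congr_fun ?_ |> fun h => h
  intro i
  rw [← inner_conj_symm x (e i), mul_comm, Complex.mul_conj, Complex.normSq_eq_norm_sq]
  norm_cast

lemma aux_adj_enn (e : HilbertBasis ι ℂ H) (A : H →L[ℂ] H) :
    ∑' i, ENNReal.ofReal (‖(star A) (e i)‖ ^ 2) = ∑' i, ENNReal.ofReal (‖A (e i)‖ ^ 2) := by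
  have key : ∀ (B : H →L[ℂ] H) i, ENNReal.ofReal (‖B (e i)‖ ^ 2)
      = ∑' j, ENNReal.ofReal (‖(inner ℂ (e j) (B (e i)) : ℂ)‖ ^ 2) := by
    intro B i
    rw [← (aux_parseval e (B (e i))).tsum_eq]
    exact ENNReal.ofReal_tsum_of_nonneg (fun _ => by positivity)
      (aux_parseval e (B (e i))).summable
  simp_rw [key]
  rw [ENNReal.tsum_comm]
  refine tsum_congr fun i => tsum_congr fun j => ?_
  rw [ContinuousLinearMap.star_eq_adjoint, ContinuousLinearMap.adjoint_inner_right,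
    norm_inner_symm]

lemma aux_summable_iff {f : ι → ℝ} (hf : ∀ i, 0 ≤ f i) :
    Summable f ↔ ∑' i, ENNReal.ofReal (f i) ≠ ⊤ := by
  constructor
  · intro h; exact h.tsum_ofReal_ne_top
  · intro h
    have := ENNReal.summable_toReal h
    simpa [ENNReal.toReal_ofReal (hf _)] using this

lemma aux_tsum_eq {f : ι → ℝ} (hf : ∀ i, 0 ≤ f i) :
    ∑' i, f i = (∑' i, ENNReal.ofReal (f i)).toReal := by
  rw [ENNReal.tsum_toReal_eq (fun _ => ENNReal.ofReal_ne_top)]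
  exact tsum_congr fun i => (ENNReal.toReal_ofReal (hf i)).symm

lemma IsHS.star {e : HilbertBasis ι ℂ H} {A : H →L[ℂ] H} (h : IsHS e A) : IsHS e (star A) := by
  unfold IsHS at *
  rw [aux_summable_iff (fun _ => by positivity)] at *
  rwa [aux_adj_enn]

lemma aux_hsNorm_star (e : HilbertBasis ι ℂ H) (A : H →L[ℂ] H) :
    hsNorm e (star A) = hsNorm e A := by
  unfold hsNorm
  rw [aux_tsum_eq (fun _ => by positivity), aux_adj_enn, ← aux_tsum_eq (fun _ => by positivity)]

lemma IsHS.mul_left {e : HilbertBasis ι ℂ H} {A : H →L[ℂ] H} (h : IsHS e A) (B : H →L[ℂ] H) :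
    IsHS e (B * A) := by
  unfold IsHS at *
  refine Summable.of_nonneg_of_le (fun _ => by positivity) (fun i => ?_) (h.mul_left (‖B‖ ^ 2))
  rw [← mul_pow]
  gcongr
  exact B.le_opNorm _

lemma IsHS.mul_right {e : HilbertBasis ι ℂ H} {A : H →L[ℂ] H} (h : IsHS e A) (B : H →L[ℂ] H) :
    IsHS e (A * B) := by
  have := (h.star.mul_left (Star.star B)).star
  simpa using this

lemma IsHS.add {e : HilbertBasis ι ℂ H} {A B : H →L[ℂ] H} (h : IsHS e A) (h' : IsHS e B) :
    IsHS e (A + B) := by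
  unfold IsHS at *
  refine Summable.of_nonneg_of_le (fun _ => by positivity) (fun i => ?_)
    ((h.add h').mul_left 2)
  have : ‖(A + B) (e i)‖ ≤ ‖A (e i)‖ + ‖B (e i)‖ := norm_add_le _ _
  have h0 : 0 ≤ ‖(A + B) (e i)‖ := norm_nonneg _
  nlinarith [sq_nonneg (‖A (e i)‖ - ‖B (e i)‖)]

lemma IsHS.smul {e : HilbertBasis ι ℂ H} {A : H →L[ℂ] H} (h : IsHS e A) (c : ℝ) :
    IsHS e (c • A) := by
  have := h.mul_left (c • (1 : H →L[ℂ] H))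
  simpa using this

lemma IsHS.sub {e : HilbertBasis ι ℂ H} {A B : H →L[ℂ] H} (h : IsHS e A) (h' : IsHS e B) :
    IsHS e (A - B) := by
  have := h.add (h'.smul (-1))
  simpa [sub_eq_add_neg] using this

lemma aux_hsNorm_smul (e : HilbertBasis ι ℂ H) (A : H →L[ℂ] H) (c : ℝ) :
    hsNorm e (c • A) = |c| * hsNorm e A := by
  unfold hsNorm
  have : ∀ i, ‖(c • A) (e i)‖ ^ 2 = c ^ 2 * ‖A (e i)‖ ^ 2 := by
    intro i
    rw [_root_.smul_apply, norm_smul, mul_pow]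
    simp
  simp_rw [this]
  rw [tsum_mul_left, Real.sqrt_mul (sq_nonneg c), Real.sqrt_sq_eq_abs]

lemma aux_hsNorm_isom (e : HilbertBasis ι ℂ H) (U A : H →L[ℂ] H) (hU : star U * U = 1) :
    hsNorm e (U * A) = hsNorm e A := by
  have hn : ∀ x, ‖U x‖ = ‖x‖ := by
    rw [ContinuousLinearMap.norm_map_iff_adjoint_comp_self]
    exact hU
  unfold hsNorm
  simp [hn]

lemma aux_hsNorm_conj (e : HilbertBasis ι ℂ H) (U A : H →L[ℂ] H) (hU : star U * U = 1) :
    hsNorm e (U * A * star U) = hsNorm e A := by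
  rw [mul_assoc, aux_hsNorm_isom e U _ hU, ← aux_hsNorm_star, star_mul, star_star,
    aux_hsNorm_isom e U _ hU, aux_hsNorm_star]

lemma MemP.pos {e : HilbertBasis ι ℂ H} {p : H →L[ℂ] H} (h : MemP e p) :
    IsStrictlyPositive p := by
  refine h.2.1.isStrictlyPositive ?_
  rw [ContinuousLinearMap.nonneg_iff_isPositive, ContinuousLinearMap.isPositive_def']
  exact ⟨h.1, fun x => h.2.2.1 x⟩

lemma MemP.of_pos {e : HilbertBasis ι ℂ H} {p : H →L[ℂ] H} (h : IsStrictlyPositive p)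
    (h' : IsHS e (p - 1)) : MemP e p := by
  have h0 := h.nonneg
  rw [ContinuousLinearMap.nonneg_iff_isPositive, ContinuousLinearMap.isPositive_def'] at h0
  exact ⟨h0.1, h.isUnit, fun x => h0.2 x, h'⟩

lemma psqrt_sa (p : H →L[ℂ] H) : IsSelfAdjoint (psqrt p) := cfc_predicate _ p
lemma pinvsqrt_sa (p : H →L[ℂ] H) : IsSelfAdjoint (pinvsqrt p) := cfc_predicate _ p

lemma aux_cont_inv {p : H →L[ℂ] H} (h : IsStrictlyPositive p) :
    ContinuousOn (fun t : ℝ => (Real.sqrt t)⁻¹) (spectrum ℝ p) := by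
  refine ContinuousOn.inv₀ (by fun_prop) fun x hx => ?_
  exact (Real.sqrt_pos.2 (h.spectrum_pos hx)).ne'

lemma psqrt_mul_self {p : H →L[ℂ] H} (h : IsStrictlyPositive p) : psqrt p * psqrt p = p := by
  unfold psqrt
  have hs : IsSelfAdjoint p := h.isSelfAdjoint
  rw [← cfc_mul Real.sqrt Real.sqrt p]
  conv_rhs => rw [← cfc_id ℝ p]
  exact cfc_congr fun x hx => Real.mul_self_sqrt (h.spectrum_pos hx).le

lemma psqrt_mul_inv {p : H →L[ℂ] H} (h : IsStrictlyPositive p) : psqrt p * pinvsqrt p = 1 := by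
  unfold psqrt pinvsqrt
  have hs : IsSelfAdjoint p := h.isSelfAdjoint
  have := aux_cont_inv h
  rw [← cfc_mul Real.sqrt _ p, ← cfc_one ℝ p]
  exact cfc_congr fun x hx => mul_inv_cancel₀ (Real.sqrt_pos.2 (h.spectrum_pos hx)).ne'

lemma pinv_mul_psqrt {p : H →L[ℂ] H} (h : IsStrictlyPositive p) : pinvsqrt p * psqrt p = 1 := by
  have := congrArg star (psqrt_mul_inv h)
  simpa [(psqrt_sa p).star_eq, (pinvsqrt_sa p).star_eq] using this

lemma psqrt_isUnit {p : H →L[ℂ] H} (h : IsStrictlyPositive p) : IsUnit (psqrt p) :=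
  ⟨⟨psqrt p, pinvsqrt p, psqrt_mul_inv h, pinv_mul_psqrt h⟩, rfl⟩

lemma pinvsqrt_isUnit {p : H →L[ℂ] H} (h : IsStrictlyPositive p) : IsUnit (pinvsqrt p) :=
  ⟨⟨pinvsqrt p, psqrt p, pinv_mul_psqrt h, psqrt_mul_inv h⟩, rfl⟩

lemma pinv_conj_self {p : H →L[ℂ] H} (h : IsStrictlyPositive p) :
    pinvsqrt p * p * pinvsqrt p = 1 := by
  calc _ = pinvsqrt p * (psqrt p * psqrt p) * pinvsqrt p := by rw [psqrt_mul_self h]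
    _ = (pinvsqrt p * psqrt p) * (psqrt p * pinvsqrt p) := by noncomm_ring
    _ = 1 := by rw [pinv_mul_psqrt h, psqrt_mul_inv h, one_mul]

lemma aux_log_hs {e : HilbertBasis ι ℂ H} {m : H →L[ℂ] H} (h : IsStrictlyPositive m)
    (hm : IsHS e (m - 1)) : IsHS e (plog m) := by
  have hs : IsSelfAdjoint m := h.isSelfAdjoint
  have hc : ContinuousOn (dslope Real.log 1) (spectrum ℝ m) := by
    have : ContinuousOn (dslope Real.log 1) (Set.Ioi 0) := by
      rw [continuousOn_dslope (Ioi_mem_nhds one_pos)]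
      exact ⟨Real.continuousOn_log.mono (fun x hx => (ne_of_gt hx : x ≠ 0)),
        Real.differentiableAt_log one_ne_zero⟩
    exact this.mono fun x hx => h.spectrum_pos hx
  have : plog m = cfc (dslope Real.log 1) m * (m - 1) := by
    have h1 : m - 1 = cfc (fun x : ℝ => x - 1) m := by
      rw [cfc_sub (fun x : ℝ => x) (fun _ => 1) m, cfc_id' ℝ m, cfc_const_one ℝ m]
    rw [h1, ← cfc_mul _ _ m]
    refine cfc_congr fun x hx => ?_
    have := sub_smul_dslope Real.log 1 x
    simp at this
    simp [← this, mul_comm]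
  rw [this]
  exact hm.mul_left _

lemma aux_exp_hs {e : HilbertBasis ι ℂ H} {A : H →L[ℂ] H} (h : IsSelfAdjoint A)
    (hm : IsHS e A) : IsHS e (NormedSpace.exp A - 1) := by
  have hc : ContinuousOn (dslope Real.exp 0) (spectrum ℝ A) := by
    have : ContinuousOn (dslope Real.exp 0) Set.univ := by
      rw [continuousOn_dslope Filter.univ_mem]
      exact ⟨Real.continuous_exp.continuousOn, Real.differentiableAt_exp⟩
    exact this.mono (Set.subset_univ _)
  have : NormedSpace.exp A - 1 = cfc (dslope Real.exp 0) A * A := by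
    conv_rhs => rw [← cfc_id' ℝ A]
    rw [cfc_id' ℝ A]
    have h2 : cfc (dslope Real.exp 0) A * A = cfc (fun x => dslope Real.exp 0 x * x) A := by
      rw [cfc_mul _ (fun x : ℝ => x) A, cfc_id' ℝ A]
    rw [h2, ← CFC.real_exp_eq_normedSpace_exp h, ← cfc_const_one ℝ A, ← cfc_sub _ _ A]
    refine cfc_congr fun x hx => ?_
    have := sub_smul_dslope Real.exp 0 x
    simp at this
    simp [← this, mul_comm]
  rw [this]
  exact hm.mul_left _

lemma aux_exp_pos {A : H →L[ℂ] H} (h : IsSelfAdjoint A) :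
    IsStrictlyPositive (NormedSpace.exp A) := by
  let +nondep : NormedAlgebra ℚ (H →L[ℂ] H) := NormedAlgebra.restrictScalars ℚ ℝ (H →L[ℂ] H)
  exact (NormedSpace.isUnit_exp A).isStrictlyPositive h.exp_nonneg

lemma aux_exp_add (A : H →L[ℂ] H) (a b : ℝ) :
    NormedSpace.exp (a • A) * NormedSpace.exp (b • A) = NormedSpace.exp ((a + b) • A) := by
  let +nondep : NormedAlgebra ℚ (H →L[ℂ] H) := NormedAlgebra.restrictScalars ℚ ℝ (H →L[ℂ] H)
  rw [add_smul, NormedSpace.exp_add_of_commute]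
  exact ((Commute.refl A).smul_left a).smul_right b

lemma aux_conj_pos {a b : H →L[ℂ] H} (hb : IsUnit b) (hs : IsSelfAdjoint b)
    (ha : IsStrictlyPositive a) : IsStrictlyPositive (b * a * b) :=
  (IsUnit.isStrictlyPositive_iff_conjugate_of_isSelfAdjoint a b hb hs).2 ha

lemma aux_geo_pos {p K : H →L[ℂ] H} (hp : IsStrictlyPositive p) (hK : IsSelfAdjoint K) (t : ℝ) :
    IsStrictlyPositive (geoCurve p K t) := by
  refine aux_conj_pos ?_ (psqrt_sa p) (aux_exp_pos ?_)
  · exact psqrt_isUnit hp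
  · exact IsSelfAdjoint.smul (IsSelfAdjoint.all t) hK

lemma aux_gdist (e : HilbertBasis ι ℂ H) {p K : H →L[ℂ] H} (hp : IsStrictlyPositive p)
    (hK : IsSelfAdjoint K) (s t : ℝ) :
    gdist e (geoCurve p K s) (geoCurve p K t) = |t - s| * hsNorm e K := by
  have hsm : ∀ c : ℝ, IsSelfAdjoint (c • K) := fun c => IsSelfAdjoint.smul (IsSelfAdjoint.all c) hK
  have ha := aux_geo_pos hp hK s
  set a := geoCurve p K s with hadef
  set r := pinvsqrt a with hr
  set w := psqrt p with hw
  have hws : star w = w := (psqrt_sa p).star_eq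
  have hrs : star r = r := (pinvsqrt_sa a).star_eq
  have hEs : ∀ c : ℝ, star (NormedSpace.exp (c • K)) = NormedSpace.exp (c • K) :=
    fun c => (aux_exp_pos (hsm c)).isSelfAdjoint.star_eq
  set x := r * w * NormedSpace.exp ((s / 2) • K) with hx
  have hxs : star x = NormedSpace.exp ((s / 2) • K) * w * r := by
    rw [hx, star_mul, star_mul, hEs, hws, hrs, mul_assoc]
  have conj : ∀ c : ℝ, x * NormedSpace.exp (c • K) * star x = r * geoCurve p K (c + s) * r := by
    intro c
    have : NormedSpace.exp ((c + s) • K) = NormedSpace.exp ((s / 2) • K) *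
        NormedSpace.exp (c • K) * NormedSpace.exp ((s / 2) • K) := by
      rw [aux_exp_add, aux_exp_add]; congr 2; ring
    rw [hxs, geoCurve, this, hx]
    simp only [mul_assoc, hw]
  have h1 : x * star x = 1 := by
    have := conj 0
    rw [zero_smul, NormedSpace.exp_zero, mul_one, zero_add, ← hadef] at this
    rw [this, hr, pinv_conj_self ha]
  have h2 : star x * x = 1 := by
    have hxu : IsUnit x := ((pinvsqrt_isUnit ha).mul (psqrt_isUnit hp)).mul
      (aux_exp_pos (hsm (s / 2))).isUnit
    obtain ⟨u, hu⟩ := hxu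
    rw [← hu] at h1 ⊢
    rw [Units.eq_inv_of_mul_eq_one_left h1, Units.inv_mul]
  have h3 : r * geoCurve p K t * r = NormedSpace.exp (x * ((t - s) • K) * star x) := by
    let +nondep : NormedAlgebra ℚ (H →L[ℂ] H) := NormedAlgebra.restrictScalars ℚ ℝ (H →L[ℂ] H)
    have := NormedSpace.exp_units_conj (⟨x, star x, h1, h2⟩ : (H →L[ℂ] H)ˣ) ((t - s) • K)
    have h4 := conj (t - s)
    rw [sub_add_cancel] at h4
    rw [← h4]
    exact this.symm
  have h5 : plog (r * geoCurve p K t * r) = x * ((t - s) • K) * star x := by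
    rw [h3]
    exact CFC.log_exp _ ((hsm (t - s)).conjugate x)
  rw [gdist, h5, aux_hsNorm_conj e x _ h2, aux_hsNorm_smul]

/-- For `p, q ∈ P`, the curve
`γ(t) = p^{1/2} exp(t log(p^{-1/2} q p^{-1/2})) p^{1/2}` stays in `P`, joins `p` to `q`,
and satisfies `d(γ(s), γ(t)) = |t − s| d(p, q)`: it is the constant-speed geodesic
of `P` through `p` and `q`. -/
theorem statement6 (e : HilbertBasis ι ℂ H) (p q : H →L[ℂ] H)
    (hp : MemP e p) (hq : MemP e q) :
    MemS2 e (plog (pinvsqrt p * q * pinvsqrt p)) ∧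
    (∀ t : ℝ, MemP e (geodesic p q t)) ∧
    geodesic p q 0 = p ∧
    geodesic p q 1 = q ∧
    (∀ s t : ℝ, gdist e (geodesic p q s) (geodesic p q t) = |t - s| * gdist e p q) := by
  have hpp := hp.pos
  have hru : IsUnit (pinvsqrt p) := pinvsqrt_isUnit hpp
  have hm : IsStrictlyPositive (pinvsqrt p * q * pinvsqrt p) :=
    aux_conj_pos hru (pinvsqrt_sa p) hq.pos
  have h1 : pinvsqrt p * p * pinvsqrt p = 1 := pinv_conj_self hpp
  have hm1 : IsHS e (pinvsqrt p * q * pinvsqrt p - 1) := by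
    have h2 := (((hq.2.2.2.sub hp.2.2.2).mul_left (pinvsqrt p)).mul_right (pinvsqrt p))
    have : pinvsqrt p * q * pinvsqrt p - 1 = pinvsqrt p * (q - 1 - (p - 1)) * pinvsqrt p := by
      rw [← h1]; noncomm_ring
    rwa [this]
  have hK : IsSelfAdjoint (plog (pinvsqrt p * q * pinvsqrt p)) := cfc_predicate _ _
  have hKh := aux_log_hs hm hm1
  refine ⟨⟨hK, hKh⟩, fun t => ?_, ?_, ?_, fun s t => ?_⟩
  · refine MemP.of_pos (aux_geo_pos hpp hK t) ?_
    have h3 := aux_exp_hs (IsSelfAdjoint.smul (IsSelfAdjoint.all t) hK) (hKh.smul t)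
    have h4 := ((h3.mul_left (psqrt p)).mul_right (psqrt p)).add hp.2.2.2
    convert h4 using 1
    rw [geodesic, geoCurve, mul_sub, sub_mul, mul_one, psqrt_mul_self hpp]
    abel
  · rw [geodesic, geoCurve, zero_smul, NormedSpace.exp_zero, mul_one, psqrt_mul_self hpp]
  · rw [geodesic, geoCurve, one_smul]
    have : NormedSpace.exp (plog (pinvsqrt p * q * pinvsqrt p)) = pinvsqrt p * q * pinvsqrt p :=
      CFC.exp_log _ hm
    rw [this]
    calc _ = (psqrt p * pinvsqrt p) * q * (pinvsqrt p * psqrt p) := by noncomm_ring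
      _ = q := by rw [psqrt_mul_inv hpp, pinv_mul_psqrt hpp, one_mul, mul_one]
  · exact aux_gdist e hpp hK s t
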